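/- Let R1 and R2 be relations over attribute sets U1 and U2, and F and G filters over U1 ∪ U2. If F ∧ nullify_{U2∖U1}(G) ≡⁺ ⊥ (i.e., F ∧ nullify_{U2∖U1}(G) never evaluates to ⊤), then σ_G(R1 ⟕_F R2) ≡ (R1 ⋈_{F ∧ G} R2) ⊎ σ_{nullify_{U2∖U1}(G)} R1. -/

import Mathlib

noncomputable section
open Classical

attribute [local instance 10] Classical.propDecidable

namespace RA

variable {A Δ : Type} [DecidableEq A] [DecidableEq Δ]

/-- Three-valued logic: true, false, unknown (error). -/
inductive TV where
  | tt | ff | unk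
deriving DecidableEq

/-- Kleene conjunction. -/
def TV.and : TV → TV → TV
  | .ff, _ => .ff
  | _, .ff => .ff
  | .tt, .tt => .tt
  | _, _ => .unk

/-- Kleene negation. -/
def TV.not : TV → TV
  | .tt => .ff
  | .ff => .tt
  | .unk => .unk

mutual
/-- Terms over attributes `A` and domain `Δ`: attributes, constants and conditionals. -/
inductive Term (A Δ : Type) where
  | attr : A → Term A Δ
  | const : Δ → Term A Δ
  | ite : Filter A Δ → Term A Δ → Term A Δ → Term A Δ

/-- RA filters: `isNull` on a (finite) set of terms, equality, conjunction, negation. -/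
inductive Filter (A Δ : Type) where
  | isNull : List (Term A Δ) → Filter A Δ
  | eq : Term A Δ → Term A Δ → Filter A Δ
  | and : Filter A Δ → Filter A Δ → Filter A Δ
  | not : Filter A Δ → Filter A Δ
end

/-- Disjunction: `F1 ∨ F2 = ¬(¬F1 ∧ ¬F2)`. -/
def Filter.or (F1 F2 : Filter A Δ) : Filter A Δ := .not ((Filter.not F1).and (Filter.not F2))

/-- The tautological filter ⊤ (`isNull` of the empty set of terms is always true). -/
def Filter.tru : Filter A Δ := .isNull []

/-- A tuple over a set of attributes: `none` marks attributes outside the set. -/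
abbrev Tuple (A Δ : Type) := A → Option Δ

mutual
/-- Evaluation of a term on a tuple (`null` is the distinguished null value of `Δ`). -/
def Term.eval (null : Δ) (t : Tuple A Δ) : Term A Δ → Δ
  | .attr a => (t a).getD null
  | .const c => c
  | .ite F v v' => if F.eval null t = TV.tt then v.eval null t else v'.eval null t

def Term.evalList (null : Δ) (t : Tuple A Δ) : List (Term A Δ) → List Δ
  | [] => []
  | v :: vs => v.eval null t :: Term.evalList null t vs

/-- Three-valued evaluation of a filter on a tuple. -/
def Filter.eval (null : Δ) (t : Tuple A Δ) : Filter A Δ → TV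
  | .isNull V => if ∀ d ∈ Term.evalList null t V, d = null then .tt else .ff
  | .eq v v' =>
      if v.eval null t = null ∨ v'.eval null t = null then .unk
      else if v.eval null t = v'.eval null t then .tt else .ff
  | .and F1 F2 => (F1.eval null t).and (F2.eval null t)
  | .not F => (F.eval null t).not
end

mutual
/-- Attributes occurring in a term. -/
def Term.attrs : Term A Δ → Finset A
  | .attr a => {a}
  | .const _ => ∅
  | .ite F v v' => F.attrs ∪ v.attrs ∪ v'.attrs

def Term.attrsList : List (Term A Δ) → Finset A
  | [] => ∅
  | v :: vs => v.attrs ∪ Term.attrsList vs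

/-- Attributes occurring in a filter. -/
def Filter.attrs : Filter A Δ → Finset A
  | .isNull V => Term.attrsList V
  | .eq v v' => v.attrs ∪ v'.attrs
  | .and F1 F2 => F1.attrs ∪ F2.attrs
  | .not F => F.attrs
end

/-- A term is over `U` if all its attributes are in `U`. -/
def Term.over (v : Term A Δ) (U : Finset A) : Prop := v.attrs ⊆ U

/-- A filter is over `U` if all its attributes are in `U`. -/
def Filter.over (F : Filter A Δ) (U : Finset A) : Prop := F.attrs ⊆ U

/-- A tuple is over `U` if its domain is exactly `U`. -/
def Tuple.isOver (t : Tuple A Δ) (U : Finset A) : Prop := ∀ a, (t a).isSome ↔ a ∈ U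

/-- A relation is a bag (multiset) of tuples. -/
abbrev Rel (A Δ : Type) := Multiset (Tuple A Δ)

/-- A relation is over `U` if all its tuples are. -/
def Rel.isOver (R : Rel A Δ) (U : Finset A) : Prop := ∀ t ∈ R, t.isOver U

/-- Selection σ_F. -/
def select (null : Δ) (F : Filter A Δ) (R : Rel A Δ) : Rel A Δ :=
  R.filter (fun t => F.eval null t = .tt)

/-- Restriction of a tuple to the attributes in `U`. -/
def Tuple.restrict (t : Tuple A Δ) (U : Finset A) : Tuple A Δ :=
  fun a => if a ∈ U then t a else none

/-- Projection π_U (bag semantics: multiplicities are added up). -/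
def proj (U : Finset A) (R : Rel A Δ) : Rel A Δ := R.map (·.restrict U)

/-- Bag difference: `(R1 ∖ R2)(t) = R1(t)` if `t ∉ R2` and `0` otherwise. -/
def bdiff (R1 R2 : Rel A Δ) : Rel A Δ := R1.filter (fun t => t ∉ R2)

/-- Compatibility of tuples: equal and non-null on the shared attributes. -/
def Compat (null : Δ) (t1 t2 : Tuple A Δ) : Prop :=
  ∀ a, (t1 a).isSome → (t2 a).isSome → (t1 a = t2 a ∧ t1 a ≠ some null)

/-- `t1 ⊕ t2`: the common extension of two (compatible) tuples. -/
def Tuple.merge (t1 t2 : Tuple A Δ) : Tuple A Δ :=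
  fun a => (t1 a).or (t2 a)

/-- Natural join. -/
def join (null : Δ) (R1 R2 : Rel A Δ) : Rel A Δ :=
  (R1.product R2).filterMap
    (fun p => if Compat null p.1 p.2 then some (p.1.merge p.2) else none)

/-- Natural join with a filter: `R1 ⋈_F R2 = σ_F (R1 ⋈ R2)`. -/
def joinF (null : Δ) (F : Filter A Δ) (R1 R2 : Rel A Δ) : Rel A Δ :=
  select null F (join null R1 R2)

/-- Padding of a tuple with `null` on the attributes of `V`. -/
def Tuple.pad (null : Δ) (V : Finset A) (t : Tuple A Δ) : Tuple A Δ :=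
  fun a => if a ∈ V then (t a).or (some null) else t a

/-- Outer union of `R1` over `U1` and `R2` over `U2`:
each relation is padded with nulls on the attributes missing from it. -/
def ounion (null : Δ) (U1 U2 : Finset A) (R1 R2 : Rel A Δ) : Rel A Δ :=
  R1.map (Tuple.pad null (U2 \ U1)) + R2.map (Tuple.pad null (U1 \ U2))

/-- Left join `R1 ⟕_F R2 = (R1 ⋈_F R2) ⊎ (R1 ∖ π_{U1}(R1 ⋈_F R2))`
for `R1` over `U1` and `R2` over `U2`. -/
def ljoin (null : Δ) (U1 U2 : Finset A) (F : Filter A Δ) (R1 R2 : Rel A Δ) : Rel A Δ :=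
  ounion null (U1 ∪ U2) U1 (joinF null F R1 R2) (bdiff R1 (proj U1 (joinF null F R1 R2)))

/-- Natural left join `R1 ⟕ R2 = R1 ⟕_⊤ R2`. -/
def nljoin (null : Δ) (U1 U2 : Finset A) (R1 R2 : Rel A Δ) : Rel A Δ :=
  ljoin null U1 U2 Filter.tru R1 R2

/-- Extension ν_{u↦v}. -/
def extend (null : Δ) (u : A) (v : Term A Δ) (R : Rel A Δ) : Rel A Δ :=
  R.map (fun t a => if a = u then some (v.eval null t) else t a)

/-- Duplicate elimination δ. -/
def dedup (R : Rel A Δ) : Rel A Δ := R.dedup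

/-- Extended renaming ρ^V_{{u/f(u) | u ∈ S}} at the level of tuples:
each attribute `u ∈ S` receives the value of the term `f u` (evaluated on the original
tuple) and the attributes of `V ∖ S` are projected away. -/
def renameFun (null : Δ) (V S : Finset A) (f : A → Term A Δ) (t : Tuple A Δ) : Tuple A Δ :=
  fun a => if a ∈ S then some ((f a).eval null t) else if a ∈ V then none else t a

/-- Extended renaming ρ^V_{{u/f(u) | u ∈ S}}. -/
def rename (null : Δ) (V S : Finset A) (f : A → Term A Δ) (R : Rel A Δ) : Rel A Δ :=
  R.map (renameFun null V S f)

/-- Renaming of the attribute `uold` into `unew` at the level of tuples. -/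
def renameAttrT (unew uold : A) (t : Tuple A Δ) : Tuple A Δ :=
  fun a => if a = unew then t uold else if a = uold then none else t a

/-- `R[unew/uold]`: the relation `R` with the attribute `uold` renamed to `unew`. -/
def renameAttr (unew uold : A) (R : Rel A Δ) : Rel A Δ := R.map (renameAttrT unew uold)

/-- `coalesce(v, v') = if(¬isNull(v), v, v')`. -/
def Term.coalesce (v v' : Term A Δ) : Term A Δ := .ite (.not (.isNull [v])) v v'

/-- The filter `⋀_{u ∈ K} ¬isNull(u)`. -/
def notNullAll (K : Finset A) : Filter A Δ :=
  K.toList.foldr (fun u acc => (Filter.not (.isNull [.attr u])).and acc) Filter.tru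

mutual
/-- `nullify_S`: replace every occurrence of an attribute from `S` by the constant null. -/
def Term.nullify (null : Δ) (S : Finset A) : Term A Δ → Term A Δ
  | .attr a => if a ∈ S then .const null else .attr a
  | .const c => .const c
  | .ite F v v' => .ite (F.nullify null S) (v.nullify null S) (v'.nullify null S)

def Term.nullifyList (null : Δ) (S : Finset A) : List (Term A Δ) → List (Term A Δ)
  | [] => []
  | v :: vs => v.nullify null S :: Term.nullifyList null S vs

/-- `nullify_S` on filters. -/
def Filter.nullify (null : Δ) (S : Finset A) : Filter A Δ → Filter A Δ
  | .isNull V => .isNull (Term.nullifyList null S V)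
  | .eq v v' => .eq (v.nullify null S) (v'.nullify null S)
  | .and F1 F2 => .and (F1.nullify null S) (F2.nullify null S)
  | .not F => .not (F.nullify null S)
end

/-- p-equivalence of filters over `U`: they are ⊤ on the same tuples over `U`. -/
def pequiv (null : Δ) (U : Finset A) (F1 F2 : Filter A Δ) : Prop :=
  ∀ t : Tuple A Δ, t.isOver U → (F1.eval null t = TV.tt ↔ F2.eval null t = TV.tt)

end RA

namespace RA

variable {A Δ : Type} [DecidableEq A] [DecidableEq Δ]

mutual
/-- Nullifying the attributes in `S` amounts to evaluating on a tuple that is null on `S`. -/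
theorem Term.eval_nullify (null : Δ) (S : Finset A) (t t' : Tuple A Δ)
    (h : ∀ a, (t' a).getD null = if a ∈ S then null else (t a).getD null) :
    ∀ v : Term A Δ, (v.nullify null S).eval null t = v.eval null t'
  | .attr a => by
    simp only [Term.nullify, Term.eval, h a]
    split_ifs <;> simp only [Term.eval]
  | .const c => by simp only [Term.nullify, Term.eval]
  | .ite F v v' => by
    simp only [Term.nullify, Term.eval, Filter.eval_nullify null S t t' h F,
      Term.eval_nullify null S t t' h v, Term.eval_nullify null S t t' h v']

theorem Term.evalList_nullifyList (null : Δ) (S : Finset A) (t t' : Tuple A Δ)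
    (h : ∀ a, (t' a).getD null = if a ∈ S then null else (t a).getD null) :
    ∀ V : List (Term A Δ),
      Term.evalList null t (Term.nullifyList null S V) = Term.evalList null t' V
  | [] => by simp only [Term.nullifyList, Term.evalList]
  | v :: vs => by
    simp only [Term.nullifyList, Term.evalList, Term.eval_nullify null S t t' h v,
      Term.evalList_nullifyList null S t t' h vs]

theorem Filter.eval_nullify (null : Δ) (S : Finset A) (t t' : Tuple A Δ)
    (h : ∀ a, (t' a).getD null = if a ∈ S then null else (t a).getD null) :
    ∀ F : Filter A Δ, (F.nullify null S).eval null t = F.eval null t'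
  | .isNull V => by
    simp only [Filter.nullify, Filter.eval, Term.evalList_nullifyList null S t t' h V]
  | .eq v v' => by
    simp only [Filter.nullify, Filter.eval, Term.eval_nullify null S t t' h v,
      Term.eval_nullify null S t t' h v']
  | .and F1 F2 => by
    simp only [Filter.nullify, Filter.eval, Filter.eval_nullify null S t t' h F1,
      Filter.eval_nullify null S t t' h F2]
  | .not F => by
    simp only [Filter.nullify, Filter.eval, Filter.eval_nullify null S t t' h F]
end

theorem TV.and_eq_tt (a b : TV) : a.and b = TV.tt ↔ a = TV.tt ∧ b = TV.tt := by
  cases a <;> cases b <;> simp [TV.and]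

/-- Padding a tuple over `U1` with nulls on `U2` evaluates like nullification. -/
theorem Filter.eval_pad (null : Δ) {U1 : Finset A} (U2 : Finset A) {t : Tuple A Δ}
    (ht : t.isOver U1) (G : Filter A Δ) :
    G.eval null (t.pad null ((U1 ∪ U2) \ U1)) = (G.nullify null (U2 \ U1)).eval null t := by
  refine (Filter.eval_nullify null _ _ _ (fun a => ?_) G).symm
  have := ht a
  by_cases h1 : a ∈ U1 <;> by_cases h2 : a ∈ U2 <;> cases h : t a <;>
    simp_all [Tuple.pad]

/-- The nullified filter does not see the attributes removed by restriction to `U1`. -/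
theorem Filter.eval_nullify_restrict (null : Δ) {U1 U2 : Finset A} {t : Tuple A Δ}
    (ht : t.isOver (U1 ∪ U2)) (G : Filter A Δ) :
    (G.nullify null (U2 \ U1)).eval null (t.restrict U1)
      = (G.nullify null (U2 \ U1)).eval null t := by
  rw [Filter.eval_nullify null _ t (t.restrict U1) (fun a => ?_) G]
  · refine Filter.eval_nullify null _ _ _ (fun a => ?_) G
    by_cases h1 : a ∈ U1 <;> simp [Tuple.restrict, h1]
  · have := ht a
    by_cases h1 : a ∈ U1 <;> by_cases h2 : a ∈ U2 <;> cases h : t a <;>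
      simp_all [Tuple.restrict]

theorem Tuple.pad_empty (null : Δ) (t : Tuple A Δ) : t.pad null ∅ = t := by
  funext a; simp [Tuple.pad]

theorem Rel.isOver_join (null : Δ) {U1 U2 : Finset A} {R1 R2 : Rel A Δ}
    (hR1 : Rel.isOver R1 U1) (hR2 : Rel.isOver R2 U2) :
    Rel.isOver (join null R1 R2) (U1 ∪ U2) := by
  intro t ht a
  simp only [join, Multiset.mem_filterMap] at ht
  obtain ⟨⟨t1, t2⟩, hp, ht⟩ := ht
  obtain ⟨h1, h2⟩ := Multiset.mem_product.mp hp
  split_ifs at ht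
  obtain rfl := Option.some.inj ht
  simp only [Tuple.merge, Option.isSome_or, Bool.or_eq_true, Finset.mem_union,
    hR1 t1 h1 a, hR2 t2 h2 a]

theorem select_joinF (null : Δ) (F G : Filter A Δ) (R1 R2 : Rel A Δ) :
    select null G (joinF null F R1 R2) = joinF null (F.and G) R1 R2 := by
  simp only [joinF, select, Multiset.filter_filter, Filter.eval, TV.and_eq_tt, and_comm]

theorem stmt16 (null : Δ) (U1 U2 : Finset A) (R1 R2 : Rel A Δ) (F G : Filter A Δ)
    (hR1 : R1.isOver U1) (hR2 : R2.isOver U2)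
    (hF : F.over (U1 ∪ U2)) (hG : G.over (U1 ∪ U2))
    (hbot : ∀ t : Tuple A Δ, t.isOver (U1 ∪ U2) →
      (F.and (G.nullify null (U2 \ U1))).eval null t ≠ TV.tt) :
    select null G (ljoin null U1 U2 F R1 R2)
      = ounion null (U1 ∪ U2) U1 (joinF null (F.and G) R1 R2)
          (select null (G.nullify null (U2 \ U1)) R1) := by
  simp only [ljoin, ounion, Finset.sdiff_eq_empty_iff_subset.mpr Finset.subset_union_left]
  rw [funext (Tuple.pad_empty null)]
  simp only [Multiset.map_id', ← select_joinF]
  simp only [select, Multiset.filter_add, Multiset.filter_map, bdiff, Multiset.filter_filter]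
  congr 2
  refine Multiset.filter_congr fun t ht => ?_
  rw [Function.comp_apply, Filter.eval_pad null U2 (hR1 t ht)]
  refine and_iff_left_of_imp fun hG' hmem => ?_
  obtain ⟨s, hs, rfl⟩ := Multiset.mem_map.mp hmem
  obtain ⟨hs, hFs⟩ := Multiset.mem_filter.mp hs
  have hso := Rel.isOver_join null hR1 hR2 s hs
  rw [Filter.eval_nullify_restrict null hso] at hG'
  exact hbot s hso (by rw [Filter.eval, TV.and_eq_tt]; exact ⟨hFs, hG'⟩)

end RA
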